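/- Let p be a prime, m ∈ ℕ, let h ∈ ℚ(p^m), σ_m ∈ ℚ(p^m), and γ > 0. Then p^m ∫_0^{p^{−m}} [ 1 + (γ/2)(1 − (h ⊕_p (σ_m + δ))²) ] dδ = 1 + (γ/2)(1 − (h ⊕_{p,m}^{simp} σ_m)²) − (γ/2) p^{−m} (h ⊕_{p,m}^{simp} σ_m) − (γ/6) p^{−2m}. -/

import Mathlib

open MeasureTheory Finset

/-- The digit of `x ∈ [0,1)` at base-`p` position `r` (the coefficient of `p^{-(r+1)}`),
using the finite expansion for `p`-adic rationals. -/
noncomputable def rdigit (p : ℕ) (x : ℝ) (r : ℕ) : ℕ :=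
  (⌊x * (p : ℝ) ^ (r + 1)⌋).toNat % p

/-- The value of the `p`-adic integer `φ_p^+(x)` modulo `p^m`, as a natural number. -/
noncomputable def truncVal (p : ℕ) (x : ℝ) (m : ℕ) : ℕ :=
  ∑ r ∈ Finset.range m, rdigit p x r * p ^ r

/-- Digit `r` of the `p`-adic sum `φ_p^+(x) +_{ℤ_p} φ_p^+(σ)`. -/
noncomputable def sdigit (p : ℕ) (x σ : ℝ) (r : ℕ) : ℕ :=
  (truncVal p x (r + 1) + truncVal p σ (r + 1)) % p ^ (r + 1) / p ^ r

/-- The `p`-adic shift `x ⊕_p σ = φ_p(φ_p^+(x) +_{ℤ_p} φ_p^+(σ))` (the Monna map applied to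
the `p`-adic sum, taken mod 1). -/
noncomputable def pshift (p : ℕ) (x σ : ℝ) : ℝ :=
  Int.fract (∑' r : ℕ, (sdigit p x σ r : ℝ) / (p : ℝ) ^ (r + 1))

/-- The simplified `p`-adic shift `x ⊕_{p,m}^{simp} σ`: the truncation of `x ⊕_p σ` to its `m`
most significant base-`p` digits. -/
noncomputable def simpShift (p m : ℕ) (x σ : ℝ) : ℝ :=
  ∑ r ∈ Finset.range m, (sdigit p x σ r : ℝ) / (p : ℝ) ^ (r + 1)

/-- The mid-simplified `p`-adic shift `x ⊕_{p,m}^{simi} σ = (x ⊕_{p,m}^{simp} σ) + 1/(2p^m)`. -/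
noncomputable def midShift (p m : ℕ) (x σ : ℝ) : ℝ :=
  simpShift p m x σ + 1 / (2 * (p : ℝ) ^ m)

/-- The radical inverse function `φ_p(n) = Σ_r n_r p^{-(r+1)}` in base `p`. -/
noncomputable def radInv (p n : ℕ) : ℝ :=
  ∑' r : ℕ, ((n / p ^ r % p : ℕ) : ℝ) / (p : ℝ) ^ (r + 1)

/-- Membership in `ℚ(p^m) = {a p^{-m} : a = 0,1,…,p^m - 1}`. -/
def QSet (p m : ℕ) (x : ℝ) : Prop :=
  ∃ a : ℕ, a < p ^ m ∧ x = (a : ℝ) / (p : ℝ) ^ m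

/-- The squared worst-case error of the QMC rule based on the `N`-element point set
`P ⊆ [0,1)^d` in the weighted anchored Sobolev space with weights `γ` (0-indexed, so the
paper's `γ_j` is `γ (j-1)`). -/
noncomputable def sqErr (d N : ℕ) (γ : ℕ → ℝ) (P : Fin N → Fin d → ℝ) : ℝ :=
  (∏ j : Fin d, (1 + γ j.val / 3))
    - 2 / (N : ℝ) * ∑ n : Fin N, ∏ j : Fin d, (1 + γ j.val / 2 * (1 - P n j ^ 2))
    + 1 / (N : ℝ) ^ 2 *
        ∑ n : Fin N, ∑ h : Fin N, ∏ j : Fin d, (1 + γ j.val * min (1 - P n j) (1 - P h j))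

theorem rdigit_eq (p : ℕ) (x : ℝ) (r : ℕ) : rdigit p x r = ⌊x * (p : ℝ) ^ (r + 1)⌋₊ % p := by
  rw [rdigit, Int.floor_toNat]

theorem rdigit_lt {p : ℕ} (hp : 0 < p) (x : ℝ) (r : ℕ) : rdigit p x r < p :=
  Nat.mod_lt _ hp

theorem truncVal_succ (p : ℕ) (x : ℝ) (n : ℕ) :
    truncVal p x (n + 1) = truncVal p x n + rdigit p x n * p ^ n :=
  Finset.sum_range_succ _ _

theorem truncVal_lt {p : ℕ} (hp : 0 < p) (x : ℝ) (n : ℕ) : truncVal p x n < p ^ n := by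
  induction n with
  | zero => simp [truncVal]
  | succ n ih =>
    rw [truncVal_succ, pow_succ']
    have := Nat.mul_le_mul_right (p ^ n) (Nat.succ_le_of_lt (rdigit_lt hp x n))
    rw [Nat.succ_mul] at this
    omega

theorem sdigit_lt {p : ℕ} (hp : 0 < p) (x σ : ℝ) (r : ℕ) : sdigit p x σ r < p := by
  rw [sdigit, Nat.div_lt_iff_lt_mul (by positivity), ← pow_succ']
  exact Nat.mod_lt _ (by positivity)

theorem hasSum_rdigit {p : ℕ} (hp : 1 < p) {y : ℝ} (hy : y ∈ Set.Ico (0 : ℝ) 1) :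
    HasSum (fun r ↦ (rdigit p y r : ℝ) / (p : ℝ) ^ (r + 1)) y := by
  have : NeZero p := ⟨by omega⟩
  refine (Real.hasSum_ofDigitsTerm_digits y hp hy).congr_fun fun r ↦ ?_
  simp [Real.ofDigitsTerm, Real.digits, rdigit_eq, div_eq_mul_inv]

/-- Digit `j` of `c + φ_p^+(y)`. -/
noncomputable def carryDigit (p c : ℕ) (y : ℝ) (j : ℕ) : ℕ :=
  (c + truncVal p y (j + 1)) % p ^ (j + 1) / p ^ j

theorem carryDigit_zero {p : ℕ} (hp : 0 < p) (y : ℝ) (j : ℕ) :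
    carryDigit p 0 y j = rdigit p y j := by
  rw [carryDigit, zero_add, Nat.mod_eq_of_lt (truncVal_lt hp y _), truncVal_succ,
    Nat.add_mul_div_right _ _ (by positivity), Nat.div_eq_of_lt (truncVal_lt hp y j), zero_add]

theorem rdigit_of_lt {p : ℕ} (hp : 1 < p) {y : ℝ} {k i : ℕ} (hy : 1 - ((p : ℝ) ^ k)⁻¹ ≤ y)
    (hy1 : y < 1) (hi : i < k) : rdigit p y i = p - 1 := by
  have hp0 : (1 : ℝ) < p := by exact_mod_cast hp
  have hpi : (0 : ℝ) < (p : ℝ) ^ (i + 1) := by positivity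
  have h1 : ((p : ℝ) ^ k)⁻¹ ≤ ((p : ℝ) ^ (i + 1))⁻¹ := by
    gcongr
    · exact hp0.le
    · exact hi
  have hf : ⌊y * (p : ℝ) ^ (i + 1)⌋₊ = p ^ (i + 1) - 1 := by
    have h1p : 1 ≤ p ^ (i + 1) := Nat.one_le_pow _ _ (by omega)
    rw [Nat.floor_eq_iff']
    · rw [Nat.cast_sub h1p]
      push_cast
      constructor
      · have : (1 - ((p : ℝ) ^ (i + 1))⁻¹) * (p : ℝ) ^ (i + 1) ≤ y * (p : ℝ) ^ (i + 1) := by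
          gcongr
          linarith
        rwa [sub_mul, inv_mul_cancel₀ hpi.ne', one_mul] at this
      · nlinarith
    · have : p ^ 1 ≤ p ^ (i + 1) := Nat.pow_le_pow_right (by omega) (by omega)
      rw [pow_one] at this
      omega
  rw [rdigit_eq, hf, pow_succ]
  have : p ^ i * p - 1 = (p - 1) + p * (p ^ i - 1) := by
    have : 1 ≤ p ^ i := Nat.one_le_pow _ _ (by omega)
    zify [this, hp.le, Nat.le_mul_of_pos_left p this |>.trans' hp.le]
    ring
  rw [this, Nat.add_mul_mod_self_left, Nat.mod_eq_of_lt (by omega)]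

theorem rdigit_add_one_lt {p : ℕ} (hp : 1 < p) {y : ℝ} {k : ℕ} (hy : 1 - ((p : ℝ) ^ k)⁻¹ ≤ y)
    (hy1 : y < 1 - ((p : ℝ) ^ (k + 1))⁻¹) : rdigit p y k + 1 < p := by
  have hp0 : (1 : ℝ) < p := by exact_mod_cast hp
  have hpk : (0 : ℝ) < (p : ℝ) ^ k := by positivity
  have hpk1 : (0 : ℝ) < (p : ℝ) ^ (k + 1) := by positivity
  have h1 : 1 ≤ p ^ k := Nat.one_le_pow _ _ (by omega)
  have h2 : 1 ≤ p ^ (k + 1) := Nat.one_le_pow _ _ (by omega)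
  have hlow : p * (p ^ k - 1) ≤ ⌊y * (p : ℝ) ^ (k + 1)⌋₊ := by
    apply Nat.le_floor
    push_cast [Nat.cast_sub h1]
    have : (1 - ((p : ℝ) ^ k)⁻¹) * (p : ℝ) ^ (k + 1) ≤ y * (p : ℝ) ^ (k + 1) := by gcongr
    have heq : (1 - ((p : ℝ) ^ k)⁻¹) * (p : ℝ) ^ (k + 1) = p * ((p : ℝ) ^ k - 1) := by
      field_simp
      ring
    rwa [heq] at this
  have hup : ⌊y * (p : ℝ) ^ (k + 1)⌋₊ < p ^ (k + 1) - 1 := by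
    rw [Nat.floor_lt']
    · push_cast [Nat.cast_sub h2]
      have : y * (p : ℝ) ^ (k + 1) < (1 - ((p : ℝ) ^ (k + 1))⁻¹) * (p : ℝ) ^ (k + 1) := by gcongr
      rwa [sub_mul, inv_mul_cancel₀ hpk1.ne', one_mul] at this
    · have : p ^ 1 ≤ p ^ (k + 1) := Nat.pow_le_pow_right (by omega) (by omega)
      rw [pow_one] at this
      omega
  rw [rdigit_eq]
  obtain ⟨d, hd⟩ := Nat.exists_eq_add_of_le hlow
  have hd' : d + 1 < p := by
    rw [hd, pow_succ', Nat.mul_sub] at hup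
    have : p * 1 ≤ p * p ^ k := Nat.mul_le_mul_left _ h1
    omega
  rw [hd, Nat.mul_add_mod, Nat.mod_eq_of_lt (by omega)]
  exact hd'

theorem truncVal_add_one {p : ℕ} (hp : 1 < p) {y : ℝ} {k : ℕ} (h : ∀ i < k, rdigit p y i = p - 1) :
    truncVal p y k + 1 = p ^ k := by
  induction k with
  | zero => simp [truncVal]
  | succ k ih =>
    rw [truncVal_succ, h k (by omega), add_right_comm, ih fun i hi ↦ h i (by omega), pow_succ']
    obtain ⟨q, rfl⟩ := Nat.exists_eq_add_of_lt hp
    simp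
    ring

theorem truncVal_add_one_lt {p : ℕ} (hp : 1 < p) {y : ℝ} {k j : ℕ} (h : rdigit p y k + 1 < p)
    (hj : k < j) : truncVal p y j + 1 < p ^ j := by
  induction j, hj using Nat.le_induction with
  | base =>
    rw [truncVal_succ, pow_succ']
    have := truncVal_lt (by omega : 0 < p) y k
    have h3 := Nat.mul_le_mul_right (p ^ k) h
    have h4 : 1 ≤ p ^ k := Nat.one_le_pow _ _ (by omega)
    simp only [Nat.succ_mul] at h3
    omega
  | succ j hj ih =>
    rw [truncVal_succ, pow_succ']
    have h3 := Nat.mul_le_mul_right (p ^ j) (Nat.succ_le_of_lt (rdigit_lt (by omega : 0 < p) y j))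
    simp only [Nat.succ_mul] at h3
    omega

theorem hasSum_carryDigit_one {p : ℕ} (hp : 1 < p) {y : ℝ} {k : ℕ} (hy0 : 0 ≤ y)
    (hy : 1 - ((p : ℝ) ^ k)⁻¹ ≤ y) (hy1 : y < 1 - ((p : ℝ) ^ (k + 1))⁻¹) :
    HasSum (fun j ↦ (carryDigit p 1 y j : ℝ) / (p : ℝ) ^ (j + 1))
      (y + (((p : ℝ) ^ (k + 1))⁻¹ - (1 - ((p : ℝ) ^ k)⁻¹))) := by
  have hp0 : (1 : ℝ) < p := by exact_mod_cast hp
  have hlt1 : y < 1 := hy1.trans (sub_lt_self _ (by positivity))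
  have hpre : ∀ i < k, rdigit p y i = p - 1 := fun i hi ↦ rdigit_of_lt hp hy hlt1 hi
  have hk := rdigit_add_one_lt hp hy hy1
  set e : ℕ → ℝ := fun j ↦ if j < k then -((p - 1) / (p : ℝ) ^ (j + 1)) else
    if j = k then ((p : ℝ) ^ (k + 1))⁻¹ else 0 with he
  have hsum : HasSum e (∑ j ∈ Finset.range (k + 1), e j) := by
    apply hasSum_sum_of_ne_finset_zero
    intro j hj
    have : k < j := by simpa using hj
    simp [he, this.not_gt, this.ne']
  have hgeom : ∀ n : ℕ, ∑ j ∈ Finset.range n, -(((p : ℝ) - 1) / (p : ℝ) ^ (j + 1)) =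
      -(1 - ((p : ℝ) ^ n)⁻¹) := by
    intro n
    induction n with
    | zero => simp
    | succ n ih =>
      rw [Finset.sum_range_succ, ih]
      field_simp
      ring
  have hval : ∑ j ∈ Finset.range (k + 1), e j =
      ((p : ℝ) ^ (k + 1))⁻¹ - (1 - ((p : ℝ) ^ k)⁻¹) := by
    rw [Finset.sum_range_succ, Finset.sum_congr rfl (g := fun j ↦ -(((p : ℝ) - 1) / (p : ℝ) ^ (j + 1)))
      fun j hj ↦ by simp [he, Finset.mem_range.1 hj], hgeom]
    simp [he]
    ring
  rw [← hval]
  refine ((hasSum_rdigit hp ⟨hy0, hlt1⟩).add hsum).congr_fun ?_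
  intro j
  rw [carryDigit]
  rcases lt_trichotomy j k with hj | rfl | hj
  · rw [add_comm 1, truncVal_add_one hp fun i hi ↦ hpre i (by omega), Nat.mod_self,
      hpre j hj, Nat.cast_sub hp.le]
    simp [he, hj]
  · have h1 := truncVal_add_one_lt hp hk j.lt_add_one
    rw [Nat.mod_eq_of_lt (by omega), truncVal_succ, ← add_assoc, add_comm 1,
      truncVal_add_one hp hpre, Nat.add_mul_div_right _ _ (by positivity),
      Nat.div_self (by positivity)]
    simp [he]
    ring
  · have h1 := truncVal_add_one_lt hp hk hj
    have h2 := truncVal_add_one_lt hp hk (hj.trans j.lt_add_one)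
    rw [Nat.mod_eq_of_lt (by omega), truncVal_succ, ← add_assoc,
      Nat.add_mul_div_right _ _ (by positivity), Nat.div_eq_of_lt (by omega)]
    simp [he, hj.not_gt, hj.ne']

theorem rdigit_natCast_div_add_of_lt {p : ℕ} (hp : 0 < p) (a : ℕ) {m r : ℕ} {y : ℝ}
    (hy : y ∈ Set.Ico (0 : ℝ) 1) (hr : r < m) :
    rdigit p ((a : ℝ) / (p : ℝ) ^ m + y / (p : ℝ) ^ m) r = a / p ^ (m - (r + 1)) % p := by
  have hp0 : (0 : ℝ) < p := by exact_mod_cast hp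
  have heq : ((a : ℝ) / (p : ℝ) ^ m + y / (p : ℝ) ^ m) * (p : ℝ) ^ (r + 1) =
      (a + y) / ((p ^ (m - (r + 1)) : ℕ) : ℝ) := by
    have : (p : ℝ) ^ m = (p : ℝ) ^ (m - (r + 1)) * (p : ℝ) ^ (r + 1) := by
      rw [← pow_add, Nat.sub_add_cancel hr]
    rw [this]
    push_cast
    field_simp
  have hfl : ⌊(a : ℝ) + y⌋₊ = a := by
    rw [Nat.floor_eq_iff (add_nonneg a.cast_nonneg hy.1)]
    exact ⟨by linarith [hy.1], by linarith [hy.2]⟩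
  rw [rdigit_eq, heq, Nat.floor_div_natCast, hfl]

theorem rdigit_natCast_div_add {p : ℕ} (hp : 0 < p) (a m i : ℕ) {y : ℝ} (hy : 0 ≤ y) :
    rdigit p ((a : ℝ) / (p : ℝ) ^ m + y / (p : ℝ) ^ m) (m + i) = rdigit p y i := by
  have hp0 : (0 : ℝ) < p := by exact_mod_cast hp
  have heq : ((a : ℝ) / (p : ℝ) ^ m + y / (p : ℝ) ^ m) * (p : ℝ) ^ (m + i + 1) =
      y * (p : ℝ) ^ (i + 1) + ((p * (a * p ^ i) : ℕ) : ℝ) := by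
    rw [add_assoc, pow_add]
    push_cast
    field_simp
    ring
  rw [rdigit_eq, heq, Nat.floor_add_natCast (by positivity), Nat.add_mul_mod_self_left, rdigit_eq]

theorem truncVal_congr {p n : ℕ} {x x' : ℝ} (h : ∀ r < n, rdigit p x r = rdigit p x' r) :
    truncVal p x n = truncVal p x' n :=
  Finset.sum_congr rfl fun r hr ↦ by rw [h r (Finset.mem_range.1 hr)]

theorem truncVal_natCast_div_add_of_le {p : ℕ} (hp : 0 < p) (a : ℕ) {m n : ℕ} {y : ℝ}
    (hy : y ∈ Set.Ico (0 : ℝ) 1) (hn : n ≤ m) :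
    truncVal p ((a : ℝ) / (p : ℝ) ^ m + y / (p : ℝ) ^ m) n =
      truncVal p ((a : ℝ) / (p : ℝ) ^ m) n := by
  refine truncVal_congr fun r hr ↦ ?_
  rw [rdigit_natCast_div_add_of_lt hp a hy (by omega),
    ← rdigit_natCast_div_add_of_lt hp a (y := 0) (by simp) (by omega : r < m), zero_div, add_zero]

theorem truncVal_natCast_div_add {p : ℕ} (hp : 0 < p) (a m j : ℕ) {y : ℝ}
    (hy : y ∈ Set.Ico (0 : ℝ) 1) :
    truncVal p ((a : ℝ) / (p : ℝ) ^ m + y / (p : ℝ) ^ m) (m + j) =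
      truncVal p ((a : ℝ) / (p : ℝ) ^ m) m + p ^ m * truncVal p y j := by
  rw [← truncVal_natCast_div_add_of_le hp a hy le_rfl, truncVal, Finset.sum_range_add, truncVal,
    truncVal, Finset.mul_sum]
  congr 1
  refine Finset.sum_congr rfl fun i _ ↦ ?_
  rw [rdigit_natCast_div_add hp a m i hy.1, pow_add]
  ring

theorem truncVal_natCast_div {p : ℕ} (hp : 0 < p) (a m j : ℕ) :
    truncVal p ((a : ℝ) / (p : ℝ) ^ m) (m + j) = truncVal p ((a : ℝ) / (p : ℝ) ^ m) m := by
  have h := truncVal_natCast_div_add hp a m j (y := 0) (by simp)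
  have h0 : truncVal p 0 j = 0 := by simp [truncVal, rdigit_eq]
  simpa [h0] using h

theorem sdigit_natCast_div_add_of_lt {p : ℕ} (hp : 0 < p) (x : ℝ) (b : ℕ) {m r : ℕ} {y : ℝ}
    (hy : y ∈ Set.Ico (0 : ℝ) 1) (hr : r < m) :
    sdigit p x ((b : ℝ) / (p : ℝ) ^ m + y / (p : ℝ) ^ m) r = sdigit p x ((b : ℝ) / (p : ℝ) ^ m) r := by
  rw [sdigit, truncVal_natCast_div_add_of_le hp b hy hr, sdigit]

/-- The carry into position `m` of the `p`-adic sum `φ_p^+(x) + φ_p^+(σ)`. -/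
noncomputable def carry (p m : ℕ) (x σ : ℝ) : ℕ :=
  (truncVal p x m + truncVal p σ m) / p ^ m

theorem carry_lt_two {p : ℕ} (hp : 0 < p) (m : ℕ) (x σ : ℝ) : carry p m x σ < 2 := by
  rw [carry, Nat.div_lt_iff_lt_mul (by positivity)]
  linarith [truncVal_lt hp x m, truncVal_lt hp σ m]

theorem sdigit_natCast_div_add {p : ℕ} (hp : 0 < p) (a b m j : ℕ) {y : ℝ}
    (hy : y ∈ Set.Ico (0 : ℝ) 1) :
    sdigit p ((a : ℝ) / (p : ℝ) ^ m) ((b : ℝ) / (p : ℝ) ^ m + y / (p : ℝ) ^ m) (m + j) =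
      carryDigit p (carry p m ((a : ℝ) / (p : ℝ) ^ m) ((b : ℝ) / (p : ℝ) ^ m)) y j := by
  rw [sdigit, add_assoc m j 1, truncVal_natCast_div hp, truncVal_natCast_div_add hp b m _ hy,
    carryDigit, carry]
  set A := truncVal p ((a : ℝ) / (p : ℝ) ^ m) m
  set B := truncVal p ((b : ℝ) / (p : ℝ) ^ m) m
  have hpm : 0 < p ^ m := by positivity
  rw [pow_add p m (j + 1), pow_add p m j, ← Nat.div_div_eq_div_mul, Nat.mod_mul_right_div_self, ← add_assoc,
    Nat.add_mul_div_left _ _ hpm]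

theorem simpShift_nonneg (p m : ℕ) (x σ : ℝ) : 0 ≤ simpShift p m x σ :=
  Finset.sum_nonneg fun _ _ ↦ by positivity

theorem simpShift_le {p : ℕ} (hp : 0 < p) (m : ℕ) (x σ : ℝ) :
    simpShift p m x σ ≤ 1 - ((p : ℝ) ^ m)⁻¹ := by
  have hp0 : (0 : ℝ) < p := by exact_mod_cast hp
  induction m with
  | zero => simp [simpShift]
  | succ m ih =>
    rw [simpShift, Finset.sum_range_succ]
    have h1 : (sdigit p x σ m : ℝ) ≤ p - 1 := by
      rw [le_sub_iff_add_le]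
      exact_mod_cast sdigit_lt hp x σ m
    have h2 : (sdigit p x σ m : ℝ) / (p : ℝ) ^ (m + 1) ≤ (p - 1) / (p : ℝ) ^ (m + 1) := by gcongr
    have h3 : ((p : ℝ) - 1) / (p : ℝ) ^ (m + 1) = ((p : ℝ) ^ m)⁻¹ - ((p : ℝ) ^ (m + 1))⁻¹ := by
      field_simp
      ring
    rw [simpShift] at ih
    linarith

theorem pshift_natCast_div_add {p : ℕ} (hp : 0 < p) (a b m : ℕ) {y t : ℝ}
    (hy : y ∈ Set.Ico (0 : ℝ) 1) (ht : t ∈ Set.Ico (0 : ℝ) 1)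
    (hsum : HasSum (fun j ↦ (carryDigit p (carry p m ((a : ℝ) / (p : ℝ) ^ m)
      ((b : ℝ) / (p : ℝ) ^ m)) y j : ℝ) / (p : ℝ) ^ (j + 1)) t) :
    pshift p ((a : ℝ) / (p : ℝ) ^ m) ((b : ℝ) / (p : ℝ) ^ m + y / (p : ℝ) ^ m) =
      simpShift p m ((a : ℝ) / (p : ℝ) ^ m) ((b : ℝ) / (p : ℝ) ^ m) + t / (p : ℝ) ^ m := by
  have hp0 : (0 : ℝ) < p := by exact_mod_cast hp
  have hpm : (0 : ℝ) < (p : ℝ) ^ m := by positivity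
  set h : ℝ := (a : ℝ) / (p : ℝ) ^ m with hh
  set σ : ℝ := (b : ℝ) / (p : ℝ) ^ m with hσ
  have htail : HasSum (fun j ↦ (sdigit p h (σ + y / (p : ℝ) ^ m) (j + m) : ℝ) /
      (p : ℝ) ^ (j + m + 1)) (t / (p : ℝ) ^ m) := by
    refine (hsum.div_const ((p : ℝ) ^ m)).congr_fun fun j ↦ ?_
    rw [add_comm j m, sdigit_natCast_div_add hp a b m j hy, div_div, ← pow_add]
    congr 2
    ring
  have hall := (hasSum_nat_add_iff (f := fun r ↦ (sdigit p h (σ + y / (p : ℝ) ^ m) r : ℝ) /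
      (p : ℝ) ^ (r + 1)) m).1 htail
  have hhead : ∑ r ∈ Finset.range m, (sdigit p h (σ + y / (p : ℝ) ^ m) r : ℝ) / (p : ℝ) ^ (r + 1) =
      simpShift p m h σ :=
    Finset.sum_congr rfl fun r hr ↦ by
      rw [sdigit_natCast_div_add_of_lt hp h b hy (Finset.mem_range.1 hr)]
  rw [hhead] at hall
  rw [pshift, hall.tsum_eq, add_comm, Int.fract_eq_self]
  have h1 := simpShift_nonneg p m h σ
  have h2 := simpShift_le hp m h σ
  have h3 : t / (p : ℝ) ^ m < ((p : ℝ) ^ m)⁻¹ := by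
    rw [← one_div]
    exact div_lt_div_of_pos_right ht.2 hpm
  have h4 : 0 ≤ t / (p : ℝ) ^ m := div_nonneg ht.1 hpm.le
  constructor <;> linarith

theorem exists_one_sub_inv_pow_le {p : ℕ} (hp : 1 < p) {y : ℝ} (hy : y ∈ Set.Ico (0 : ℝ) 1) :
    ∃ k : ℕ, y ∈ Set.Ico (1 - ((p : ℝ) ^ k)⁻¹) (1 - ((p : ℝ) ^ (k + 1))⁻¹) := by
  have hp0 : (1 : ℝ) < p := by exact_mod_cast hp
  obtain ⟨k, h1, h2⟩ := exists_nat_pow_near_of_lt_one (x := 1 - y) (y := (p : ℝ)⁻¹)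
    (by linarith [hy.2]) (by linarith [hy.1]) (by positivity) (inv_lt_one_of_one_lt₀ hp0)
  rw [inv_pow] at h1 h2
  exact ⟨k, by linarith, by linarith⟩

theorem iUnion_Ico_one_sub_inv_pow {p : ℕ} (hp : 1 < p) :
    ⋃ k : ℕ, Set.Ico (1 - ((p : ℝ) ^ k)⁻¹) (1 - ((p : ℝ) ^ (k + 1))⁻¹) = Set.Ico 0 1 := by
  have hp0 : (1 : ℝ) < p := by exact_mod_cast hp
  ext y
  rw [Set.mem_iUnion]
  refine ⟨fun ⟨k, h1, h2⟩ ↦ ⟨?_, ?_⟩, exists_one_sub_inv_pow_le hp⟩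
  · linarith [inv_le_one_of_one_le₀ (one_le_pow₀ hp0.le : 1 ≤ (p : ℝ) ^ k)]
  · exact h2.trans (sub_lt_self _ (by positivity))

theorem iUnion_Ioc_inv_pow {p : ℕ} (hp : 1 < p) :
    ⋃ k : ℕ, Set.Ioc ((p : ℝ) ^ (k + 1))⁻¹ ((p : ℝ) ^ k)⁻¹ = Set.Ioc 0 1 := by
  have hp0 : (1 : ℝ) < p := by exact_mod_cast hp
  ext y
  rw [Set.mem_iUnion]
  refine ⟨fun ⟨k, h1, h2⟩ ↦ ⟨lt_trans (by positivity) h1, h2.trans ?_⟩, fun h ↦ ?_⟩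
  · exact inv_le_one_of_one_le₀ (one_le_pow₀ hp0.le)
  · obtain ⟨k, h1, h2⟩ := exists_nat_pow_near_of_lt_one (x := y) (y := (p : ℝ)⁻¹)
      h.1 h.2 (by positivity) (inv_lt_one_of_one_lt₀ hp0)
    rw [inv_pow] at h1 h2
    exact ⟨k, h1, h2⟩

/-- Invariance of Lebesgue measure under the `p`-adic odometer. -/
theorem setIntegral_eq_of_odometer {p : ℕ} (hp : 1 < p) {f g : ℝ → ℝ} (hf : Continuous f)
    (hg : ∀ k : ℕ, ∀ y ∈ Set.Ico (1 - ((p : ℝ) ^ k)⁻¹) (1 - ((p : ℝ) ^ (k + 1))⁻¹),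
      g y = f (y + (((p : ℝ) ^ (k + 1))⁻¹ - (1 - ((p : ℝ) ^ k)⁻¹)))) :
    ∫ y in Set.Ico (0 : ℝ) 1, g y = ∫ y in (0 : ℝ)..1, f y := by
  have hp0 : (1 : ℝ) < p := by exact_mod_cast hp
  have hanti : Antitone fun k : ℕ ↦ ((p : ℝ) ^ k)⁻¹ := fun i j hij ↦ by
    have := hp0.le
    dsimp only
    gcongr
  have hmono : Monotone fun k : ℕ ↦ 1 - ((p : ℝ) ^ k)⁻¹ := fun i j hij ↦
    sub_le_sub_left (hanti hij) 1
  have hpiece : ∀ (φ ψ : ℝ → ℝ) (k : ℕ),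
      (∀ y ∈ Set.Ico (1 - ((p : ℝ) ^ k)⁻¹) (1 - ((p : ℝ) ^ (k + 1))⁻¹),
        ψ y = φ (y + (((p : ℝ) ^ (k + 1))⁻¹ - (1 - ((p : ℝ) ^ k)⁻¹)))) →
      ∫ y in Set.Ico (1 - ((p : ℝ) ^ k)⁻¹) (1 - ((p : ℝ) ^ (k + 1))⁻¹), ψ y =
        ∫ y in Set.Ioc ((p : ℝ) ^ (k + 1))⁻¹ ((p : ℝ) ^ k)⁻¹, φ y := by
    intro φ ψ k hk
    rw [setIntegral_congr_fun measurableSet_Ico hk, integral_Ico_eq_integral_Ioc,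
      ← intervalIntegral.integral_of_le (hmono (Nat.le_add_right k 1)),
      ← intervalIntegral.integral_of_le (hanti (Nat.le_add_right k 1)),
      intervalIntegral.integral_comp_add_right]
    congr 1 <;> ring
  have hfint : ∀ φ : ℝ → ℝ, Continuous φ → HasSum
      (fun k : ℕ ↦ ∫ y in Set.Ioc ((p : ℝ) ^ (k + 1))⁻¹ ((p : ℝ) ^ k)⁻¹, φ y)
      (∫ y in (0 : ℝ)..1, φ y) := by
    intro φ hφ
    rw [intervalIntegral.integral_of_le zero_le_one, ← iUnion_Ioc_inv_pow hp]
    refine hasSum_integral_iUnion (fun _ ↦ measurableSet_Ioc)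
      hanti.pairwise_disjoint_on_Ioc_succ ?_
    rw [iUnion_Ioc_inv_pow hp]
    exact hφ.integrableOn_Ioc
  have hgint : IntegrableOn g
      (⋃ k : ℕ, Set.Ico (1 - ((p : ℝ) ^ k)⁻¹) (1 - ((p : ℝ) ^ (k + 1))⁻¹)) := by
    refine integrableOn_iUnion_of_summable_integral_norm (fun k ↦ ?_) ?_
    · refine IntegrableOn.congr_fun ?_ (fun y hy ↦ (hg k y hy).symm) measurableSet_Ico
      exact (by fun_prop : Continuous fun y ↦
        f (y + (((p : ℝ) ^ (k + 1))⁻¹ - (1 - ((p : ℝ) ^ k)⁻¹)))).integrableOn_Icc.mono_set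
          Set.Ico_subset_Icc_self
    · refine (hfint (fun y ↦ ‖f y‖) hf.norm).summable.congr fun k ↦ ?_
      exact (hpiece (fun y ↦ ‖f y‖) (fun y ↦ ‖g y‖) k fun y hy ↦ by rw [hg k y hy]).symm
  rw [← iUnion_Ico_one_sub_inv_pow hp, ← (hfint f hf).tsum_eq]
  refine (integral_iUnion (fun _ ↦ measurableSet_Ico)
    hmono.pairwise_disjoint_on_Ico_succ hgint).trans ?_
  exact tsum_congr fun k ↦ hpiece f g k (hg k)

theorem setIntegral_comp_pshift {p : ℕ} (hp : 1 < p) (a b m : ℕ) {f : ℝ → ℝ} (hf : Continuous f) :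
    ∫ y in Set.Ico (0 : ℝ) 1,
        f (pshift p ((a : ℝ) / (p : ℝ) ^ m) ((b : ℝ) / (p : ℝ) ^ m + y / (p : ℝ) ^ m)) =
      ∫ y in (0 : ℝ)..1,
        f (simpShift p m ((a : ℝ) / (p : ℝ) ^ m) ((b : ℝ) / (p : ℝ) ^ m) + y / (p : ℝ) ^ m) := by
  have hp' : 0 < p := by omega
  have hp0 : (1 : ℝ) < p := by exact_mod_cast hp
  have hc := carry_lt_two hp' m ((a : ℝ) / (p : ℝ) ^ m) ((b : ℝ) / (p : ℝ) ^ m)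
  have key := fun y t ↦ pshift_natCast_div_add hp' a b m (y := y) (t := t)
  generalize carry p m ((a : ℝ) / (p : ℝ) ^ m) ((b : ℝ) / (p : ℝ) ^ m) = c at hc key
  obtain rfl | rfl : c = 0 ∨ c = 1 := by omega
  · rw [intervalIntegral.integral_of_le zero_le_one, ← integral_Ico_eq_integral_Ioc]
    refine setIntegral_congr_fun measurableSet_Ico fun y hy ↦ ?_
    have hs := hasSum_rdigit hp hy
    simp only [← carryDigit_zero hp'] at hs
    simp only [key y y hy hy hs]
  · refine setIntegral_eq_of_odometer hp (f := fun y ↦ f (simpShift p m ((a : ℝ) / (p : ℝ) ^ m)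
      ((b : ℝ) / (p : ℝ) ^ m) + y / (p : ℝ) ^ m)) (by fun_prop) fun k y hy ↦ ?_
    have hy01 : y ∈ Set.Ico (0 : ℝ) 1 := by
      rw [← iUnion_Ico_one_sub_inv_pow hp]
      exact Set.mem_iUnion_of_mem k hy
    have hk1 : ((p : ℝ) ^ k)⁻¹ ≤ 1 := inv_le_one_of_one_le₀ (one_le_pow₀ hp0.le)
    have hk2 : 0 < ((p : ℝ) ^ (k + 1))⁻¹ := by positivity
    rw [key y _ hy01 ⟨by linarith [hy.1], by linarith [hy.2]⟩
      (hasSum_carryDigit_one hp hy01.1 hy.1 hy.2)]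

/-- exact evaluation of the cell average of
`1 + (γ/2)(1 - (h ⊕_p (σ_m + δ))²)`. -/
theorem cell_average_quadratic_term
    (p : ℕ) (hp : p.Prime) (m : ℕ) (hm : 0 < m)
    (h σm : ℝ) (hh : QSet p m h) (hσ : QSet p m σm)
    (γ : ℝ) (hγ : 0 < γ) :
    (p : ℝ) ^ m *
        ∫ δ in Set.Ico (0 : ℝ) (((p : ℝ) ^ m)⁻¹),
          (1 + γ / 2 * (1 - pshift p h (σm + δ) ^ 2)) =
      1 + γ / 2 * (1 - simpShift p m h σm ^ 2) -
        γ / 2 * ((p : ℝ) ^ m)⁻¹ * simpShift p m h σm - γ / 6 * ((p : ℝ) ^ (2 * m))⁻¹ := by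
  obtain ⟨a, -, rfl⟩ := hh
  obtain ⟨b, -, rfl⟩ := hσ
  have hpm : (0 : ℝ) < (p : ℝ) ^ m := by
    have : (0 : ℝ) < p := by exact_mod_cast hp.pos
    positivity
  have hmain := setIntegral_comp_pshift hp.one_lt a b m
    (f := fun t ↦ 1 + γ / 2 * (1 - t ^ 2)) (by fun_prop)
  have hscale := intervalIntegral.mul_integral_comp_mul_left (a := 0) (b := ((p : ℝ) ^ m)⁻¹)
    (c := (p : ℝ) ^ m) (f := fun y ↦ 1 + γ / 2 * (1 - pshift p ((a : ℝ) / (p : ℝ) ^ m)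
      ((b : ℝ) / (p : ℝ) ^ m + y / (p : ℝ) ^ m) ^ 2))
  simp only [mul_div_cancel_left₀ _ hpm.ne', mul_zero, mul_inv_cancel₀ hpm.ne'] at hscale
  rw [integral_Ico_eq_integral_Ioc, ← intervalIntegral.integral_of_le zero_le_one] at hmain
  rw [integral_Ico_eq_integral_Ioc, ← intervalIntegral.integral_of_le (inv_nonneg.2 hpm.le),
    hscale, hmain]
  generalize simpShift p m ((a : ℝ) / (p : ℝ) ^ m) ((b : ℝ) / (p : ℝ) ^ m) = s
  rw [mul_comm 2 m, pow_mul]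
  generalize (p : ℝ) ^ m = q at hpm
  have hderiv : ∀ y ∈ Set.uIcc (0 : ℝ) 1, HasDerivAt
      (fun y ↦ y + γ / 2 * (y - q / 3 * (s + y / q) ^ 3)) (1 + γ / 2 * (1 - (s + y / q) ^ 2)) y := by
    intro y _
    have h1 := (((hasDerivAt_id y).div_const q).const_add s).pow 3
    have h2 := (hasDerivAt_id y).add
      (((hasDerivAt_id y).sub (h1.const_mul (q / 3))).const_mul (γ / 2))
    refine h2.congr_deriv ?_
    simp only [id_eq]
    push_cast
    field_simp
  rw [intervalIntegral.integral_eq_sub_of_hasDerivAt hderiv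
    (Continuous.intervalIntegrable (by fun_prop) _ _)]
  field_simp
  ring
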